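/- Let γ > 1, let N ∈ ℕ, let μ_1, …, μ_N ∈ ℝ, and let f : (0, ∞) → [0, ∞] be measurable. Assume that for every t > 0 one has Σ_{j=1}^N (μ_j + t)_- ≤ f(t). Then Σ_{j=1}^N ((μ_j)_-)^γ ≤ γ(γ-1) ∫_0^∞ t^{γ-2} f(t) dt. -/

import Mathlib

open MeasureTheory
open scoped ENNReal

/-- The negative part of a real number: `t₋ = max(0, -t)`. -/
noncomputable def negPt (t : ℝ) : ℝ := max 0 (-t)

lemma negPt_nonneg (t : ℝ) : 0 ≤ negPt t := le_max_left _ _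

lemma measurable_negPt : Measurable negPt := by
  unfold negPt
  fun_prop

lemma negPt_of_nonneg {t : ℝ} (ht : 0 ≤ t) : negPt t = 0 :=
  max_eq_left (by linarith)

lemma negPt_of_nonpos {t : ℝ} (ht : t ≤ 0) : negPt t = -t :=
  max_eq_right (by linarith)

lemma intervalIntegrable_rpow_mul_sub {γ : ℝ} (hγ : 1 < γ) (a : ℝ) :
    IntervalIntegrable (fun t : ℝ => t ^ (γ - 2) * (a - t)) volume 0 a :=
  (intervalIntegral.intervalIntegrable_rpow' (by linarith)).mul_continuousOn
    (continuous_const.sub continuous_id).continuousOn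

lemma integral_rpow_mul_sub {γ : ℝ} (hγ : 1 < γ) {a : ℝ} (ha : 0 < a) :
    ∫ t in (0 : ℝ)..a, t ^ (γ - 2) * (a - t) = a ^ γ / (γ * (γ - 1)) := by
  have hsplit : ∫ t in (0 : ℝ)..a, t ^ (γ - 2) * (a - t) =
      ∫ t in (0 : ℝ)..a, (a * t ^ (γ - 2) - t ^ (γ - 1)) := by
    refine intervalIntegral.integral_congr_uIoo fun t ht => ?_
    rw [Set.uIoo_of_le ha.le] at ht
    have hpow : t ^ (γ - 1) = t ^ (γ - 2) * t := by
      rw [← Real.rpow_add_one ht.1.ne']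
      congr 1
      ring
    simp only [hpow]
    ring
  have hpow : a ^ γ = a ^ (γ - 1) * a := by
    rw [← Real.rpow_add_one ha.ne', sub_add_cancel]
  rw [hsplit, intervalIntegral.integral_sub
      ((intervalIntegral.intervalIntegrable_rpow' (by linarith)).const_mul a)
      (intervalIntegral.intervalIntegrable_rpow' (by linarith)),
    intervalIntegral.integral_const_mul, integral_rpow (Or.inl (by linarith)),
    integral_rpow (Or.inl (by linarith)), show γ - 2 + 1 = γ - 1 by ring, sub_add_cancel,
    Real.zero_rpow (by linarith), Real.zero_rpow (by linarith), hpow]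
  have h₀ : γ ≠ 0 := by linarith
  have h₁ : γ - 1 ≠ 0 := by linarith
  field_simp
  ring

/-- The Aizenman–Lieb identity `∫₀^∞ t^(γ-2) (s+t)₋ dt = (s₋)^γ / (γ (γ-1))`. -/
lemma lintegral_rpow_mul_negPt_add {γ : ℝ} (hγ : 1 < γ) (s : ℝ) :
    ∫⁻ t in Set.Ioi (0 : ℝ), ENNReal.ofReal (t ^ (γ - 2) * negPt (s + t)) =
      ENNReal.ofReal (negPt s ^ γ / (γ * (γ - 1))) := by
  rcases le_or_gt 0 s with hs | hs
  · rw [negPt_of_nonneg hs, Real.zero_rpow (by linarith), zero_div, ENNReal.ofReal_zero]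
    refine setLIntegral_eq_zero measurableSet_Ioi fun t ht => ?_
    simp [negPt_of_nonneg (add_nonneg hs (Set.mem_Ioi.1 ht).le)]
  · have ha : 0 < -s := neg_pos.2 hs
    rw [← Set.Ioc_union_Ioi_eq_Ioi ha.le,
      lintegral_union measurableSet_Ioi (Set.Ioc_disjoint_Ioi le_rfl)]
    have htail : ∫⁻ t in Set.Ioi (-s), ENNReal.ofReal (t ^ (γ - 2) * negPt (s + t)) = 0 := by
      refine setLIntegral_eq_zero measurableSet_Ioi fun t ht => ?_
      have hst : 0 ≤ s + t := by linarith [Set.mem_Ioi.1 ht]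
      simp [negPt_of_nonneg hst]
    have hmain : ∫⁻ t in Set.Ioc 0 (-s), ENNReal.ofReal (t ^ (γ - 2) * negPt (s + t)) =
        ∫⁻ t in Set.Ioc 0 (-s), ENNReal.ofReal (t ^ (γ - 2) * (-s - t)) := by
      refine setLIntegral_congr_fun measurableSet_Ioc fun t ht => ?_
      have hst : s + t ≤ 0 := by linarith [ht.2]
      simp only [negPt_of_nonpos hst, neg_add']
    rw [htail, add_zero, hmain, negPt_of_nonpos hs.le, ← integral_rpow_mul_sub hγ ha,
      intervalIntegral.integral_of_le ha.le, ofReal_integral_eq_lintegral_ofReal]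
    · exact (intervalIntegrable_iff_integrableOn_Ioc_of_le ha.le).1
        (intervalIntegrable_rpow_mul_sub hγ (-s))
    · refine (ae_restrict_iff' measurableSet_Ioc).2 (.of_forall fun t ht => ?_)
      exact mul_nonneg (Real.rpow_nonneg ht.1.le _) (sub_nonneg.2 ht.2)

theorem stmt1 (γ : ℝ) (hγ : 1 < γ) (N : ℕ) (μ : Fin N → ℝ)
    (f : ℝ → ℝ≥0∞) (hf : Measurable f)
    (hbd : ∀ t : ℝ, 0 < t → ENNReal.ofReal (∑ j, negPt (μ j + t)) ≤ f t) :
    ENNReal.ofReal (∑ j, negPt (μ j) ^ γ) ≤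
      ENNReal.ofReal (γ * (γ - 1)) *
        ∫⁻ t in Set.Ioi (0:ℝ), ENNReal.ofReal (t ^ (γ - 2)) * f t := by
  have hc : 0 < γ * (γ - 1) := mul_pos (by linarith) (by linarith)
  have hmeas (j : Fin N) :
      Measurable fun t : ℝ => ENNReal.ofReal (t ^ (γ - 2) * negPt (μ j + t)) := by
    have := measurable_negPt
    fun_prop
  calc ENNReal.ofReal (∑ j, negPt (μ j) ^ γ)
      = ENNReal.ofReal (γ * (γ - 1)) *
          ∑ j, ENNReal.ofReal (negPt (μ j) ^ γ / (γ * (γ - 1))) := by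
        rw [← ENNReal.ofReal_sum_of_nonneg fun j _ =>
            div_nonneg (Real.rpow_nonneg (negPt_nonneg _) _) hc.le,
          ← ENNReal.ofReal_mul hc.le, ← Finset.sum_div, mul_div_cancel₀ _ hc.ne']
    _ = ENNReal.ofReal (γ * (γ - 1)) * ∫⁻ t in Set.Ioi (0 : ℝ),
          ∑ j, ENNReal.ofReal (t ^ (γ - 2) * negPt (μ j + t)) := by
        rw [lintegral_finsetSum _ fun j _ => hmeas j]
        simp only [lintegral_rpow_mul_negPt_add hγ]
    _ ≤ _ := by
        refine mul_le_mul_right (setLIntegral_mono' measurableSet_Ioi fun t ht => ?_) _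
        have hpow : 0 ≤ t ^ (γ - 2) := Real.rpow_nonneg (Set.mem_Ioi.1 ht).le _
        rw [← ENNReal.ofReal_sum_of_nonneg fun j _ => mul_nonneg hpow (negPt_nonneg _),
          ← Finset.mul_sum, ENNReal.ofReal_mul hpow]
        exact mul_le_mul_right (hbd t ht) _
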